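/- Let N ≥ 2, let p = (p_1,…,p_s) consist of s distinct primes, and let γ = (γ_j)_{j≥1} be a non-increasing sequence of weights with 1 ≥ γ_1 ≥ γ_2 ≥ … > 0. Then the mean square worst-case error of the p-adically shifted Halton point set, averaged over all shifts σ ∈ [0,1)^s, satisfies ∫_{[0,1]^s} e²_{N,s}(H_{p,N} ⊕_p σ) dσ ≤ (1/N²) [ Π_{j=1}^s (1 + γ_j (log N) p_j²/log p_j) + Π_{j=1}^s (1 + γ_j/2) · Π_{j=1}^s (1 + γ_j p_j/6) ]. -/

import Mathlib

open MeasureTheory Finset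

/-- The digit of `x ∈ [0,1)` at base-`p` position `r` (the coefficient of `p^{-(r+1)}`),
using the finite expansion for `p`-adic rationals. -/
noncomputable def rdigit (p : ℕ) (x : ℝ) (r : ℕ) : ℕ :=
  (⌊x * (p : ℝ) ^ (r + 1)⌋).toNat % p

/-- The value of the `p`-adic integer `φ_p^+(x)` modulo `p^m`, as a natural number. -/
noncomputable def truncVal (p : ℕ) (x : ℝ) (m : ℕ) : ℕ :=
  ∑ r ∈ Finset.range m, rdigit p x r * p ^ r

/-- Digit `r` of the `p`-adic sum `φ_p^+(x) +_{ℤ_p} φ_p^+(σ)`. -/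
noncomputable def sdigit (p : ℕ) (x σ : ℝ) (r : ℕ) : ℕ :=
  (truncVal p x (r + 1) + truncVal p σ (r + 1)) % p ^ (r + 1) / p ^ r

/-- The `p`-adic shift `x ⊕_p σ = φ_p(φ_p^+(x) +_{ℤ_p} φ_p^+(σ))` (the Monna map applied to
the `p`-adic sum, taken mod 1). -/
noncomputable def pshift (p : ℕ) (x σ : ℝ) : ℝ :=
  Int.fract (∑' r : ℕ, (sdigit p x σ r : ℝ) / (p : ℝ) ^ (r + 1))

/-- The simplified `p`-adic shift `x ⊕_{p,m}^{simp} σ`: the truncation of `x ⊕_p σ` to its `m`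
most significant base-`p` digits. -/
noncomputable def simpShift (p m : ℕ) (x σ : ℝ) : ℝ :=
  ∑ r ∈ Finset.range m, (sdigit p x σ r : ℝ) / (p : ℝ) ^ (r + 1)

/-- The mid-simplified `p`-adic shift `x ⊕_{p,m}^{simi} σ = (x ⊕_{p,m}^{simp} σ) + 1/(2p^m)`. -/
noncomputable def midShift (p m : ℕ) (x σ : ℝ) : ℝ :=
  simpShift p m x σ + 1 / (2 * (p : ℝ) ^ m)

/-- The radical inverse function `φ_p(n) = Σ_r n_r p^{-(r+1)}` in base `p`. -/
noncomputable def radInv (p n : ℕ) : ℝ :=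
  ∑' r : ℕ, ((n / p ^ r % p : ℕ) : ℝ) / (p : ℝ) ^ (r + 1)

/-- Membership in `ℚ(p^m) = {a p^{-m} : a = 0,1,…,p^m - 1}`. -/
def QSet (p m : ℕ) (x : ℝ) : Prop :=
  ∃ a : ℕ, a < p ^ m ∧ x = (a : ℝ) / (p : ℝ) ^ m

/-- The squared worst-case error of the QMC rule based on the `N`-element point set
`P ⊆ [0,1)^d` in the weighted anchored Sobolev space with weights `γ` (0-indexed, so the
paper's `γ_j` is `γ (j-1)`). -/
noncomputable def sqErr (d N : ℕ) (γ : ℕ → ℝ) (P : Fin N → Fin d → ℝ) : ℝ :=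
  (∏ j : Fin d, (1 + γ j.val / 3))
    - 2 / (N : ℝ) * ∑ n : Fin N, ∏ j : Fin d, (1 + γ j.val / 2 * (1 - P n j ^ 2))
    + 1 / (N : ℝ) ^ 2 *
        ∑ n : Fin N, ∑ h : Fin N, ∏ j : Fin d, (1 + γ j.val * min (1 - P n j) (1 - P h j))

lemma rdigit_add_div_zero {p a : ℕ} (ha : a < p) {t : ℝ} (ht : t ∈ Set.Ico (0 : ℝ) 1) :
    rdigit p ((a + t) / p) 0 = a := by
  have hp : (p : ℝ) ≠ 0 := by
    have : 0 < p := by omega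
    positivity
  have h : ((a : ℝ) + t) / p * (p : ℝ) ^ (0 + 1) = a + t := by
    rw [zero_add, pow_one]; field_simp
  have ht0 : ⌊t⌋ = 0 := Int.floor_eq_zero_iff.2 ht
  rw [rdigit, h, Int.floor_natCast_add, ht0, add_zero, Int.toNat_natCast, Nat.mod_eq_of_lt ha]

lemma rdigit_add_div_succ {p : ℕ} (hp : 0 < p) (a : ℕ) {t : ℝ} (ht : 0 ≤ t) (r : ℕ) :
    rdigit p ((a + t) / p) (r + 1) = rdigit p t r := by
  have hp' : (p : ℝ) ≠ 0 := by positivity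
  have h : ((a : ℝ) + t) / p * (p : ℝ) ^ (r + 1 + 1)
      = ((a * p ^ (r + 1) : ℕ) : ℝ) + t * (p : ℝ) ^ (r + 1) := by
    push_cast; rw [pow_succ (p : ℝ) (r + 1)]; field_simp
  have h0 : 0 ≤ ⌊t * (p : ℝ) ^ (r + 1)⌋ := Int.floor_nonneg.2 (by positivity)
  rw [rdigit, rdigit, h, Int.floor_natCast_add]
  obtain ⟨b, hb⟩ := Int.eq_ofNat_of_zero_le h0
  rw [hb, ← Nat.cast_add, Int.toNat_natCast, Int.toNat_natCast, pow_succ, ← mul_assoc,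
    Nat.mul_add_mod_self_right]

lemma summable_digits {p : ℕ} (hp : 2 ≤ p) {d : ℕ → ℕ} (hd : ∀ r, d r < p) :
    Summable fun r => (d r : ℝ) / (p : ℝ) ^ (r + 1) := by
  have hp' : (2 : ℝ) ≤ p := by exact_mod_cast hp
  refine Summable.of_nonneg_of_le (fun r => by positivity) (fun r => ?_)
    (summable_geometric_of_lt_one (r := (p : ℝ)⁻¹) (by positivity)
      (inv_lt_one_of_one_lt₀ (by linarith)))
  have : (d r : ℝ) ≤ p := by exact_mod_cast (hd r).le
  rw [inv_pow, div_le_iff₀ (by positivity), pow_succ]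
  field_simp
  exact this

lemma tsum_digits_mem_Icc {p : ℕ} (hp : 2 ≤ p) {d : ℕ → ℕ} (hd : ∀ r, d r < p) :
    (∑' r, (d r : ℝ) / (p : ℝ) ^ (r + 1)) ∈ Set.Icc (0 : ℝ) 1 := by
  have hp' : (2 : ℝ) ≤ p := by exact_mod_cast hp
  refine ⟨tsum_nonneg fun r => by positivity, ?_⟩
  have hg : HasSum (fun r : ℕ => ((p : ℝ) - 1) / p * (p : ℝ)⁻¹ ^ r) 1 := by
    have := (hasSum_geometric_of_lt_one (r := (p : ℝ)⁻¹) (by positivity)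
      (inv_lt_one_of_one_lt₀ (by linarith))).mul_left (((p : ℝ) - 1) / p)
    have h1 : (p : ℝ) - 1 ≠ 0 := by linarith
    have h2 : (1 - (p : ℝ)⁻¹) = ((p : ℝ) - 1) / p := by field_simp
    rwa [h2, mul_inv_cancel₀ (div_ne_zero h1 (by positivity))] at this
  rw [← hg.tsum_eq]
  refine (summable_digits hp hd).tsum_le_tsum (fun r => ?_) hg.summable
  have : (d r : ℝ) ≤ p - 1 := by
    have : (d r : ℝ) + 1 ≤ p := by exact_mod_cast hd r
    linarith
  rw [inv_pow, div_le_iff₀ (by positivity), pow_succ]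
  field_simp
  exact this

lemma tsum_digits_succ {p : ℕ} (hp : 2 ≤ p) {d : ℕ → ℕ} (hd : ∀ r, d r < p) :
    (∑' r, (d r : ℝ) / (p : ℝ) ^ (r + 1)) =
      (d 0 + ∑' r, (d (r + 1) : ℝ) / (p : ℝ) ^ (r + 1)) / p := by
  have hp' : (p : ℝ) ≠ 0 := by positivity
  rw [(summable_digits hp hd).tsum_eq_zero_add, add_div, ← tsum_div_const]
  congr 1
  · simp
  · refine tsum_congr fun r => ?_
    rw [pow_succ (p : ℝ) (r + 1)]; field_simp

lemma radInv_rec {p : ℕ} (hp : 2 ≤ p) (n : ℕ) :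
    radInv p n = ((n % p : ℕ) + radInv p (n / p)) / p := by
  rw [radInv, tsum_digits_succ hp (fun r => Nat.mod_lt _ (by omega))]
  simp only [pow_zero, Nat.div_one, radInv, Nat.div_div_eq_div_mul, ← pow_succ']

lemma radInv_mem_Ico {p : ℕ} (hp : 2 ≤ p) (n : ℕ) : radInv p n ∈ Set.Ico (0 : ℝ) 1 := by
  induction n using Nat.strong_induction_on with
  | _ n ih =>
    rcases Nat.eq_zero_or_pos n with rfl | hn
    · simp [radInv]
    · obtain ⟨h0, h1⟩ := ih (n / p) (Nat.div_lt_self hn (by omega))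
      have h2 : ((n % p : ℕ) : ℝ) + 1 ≤ p := by exact_mod_cast Nat.mod_lt n (by omega)
      have hp' : (0 : ℝ) < p := by positivity
      rw [radInv_rec hp]
      exact ⟨by positivity, by rw [div_lt_one hp']; linarith⟩

lemma rdigit_radInv {p : ℕ} (hp : 2 ≤ p) (n r : ℕ) :
    rdigit p (radInv p n) r = n / p ^ r % p := by
  induction r generalizing n with
  | zero =>
    rw [radInv_rec hp, rdigit_add_div_zero (Nat.mod_lt _ (by omega)) (radInv_mem_Ico hp _)]
    simp
  | succ r ih =>
    rw [radInv_rec hp, rdigit_add_div_succ (by omega) _ (radInv_mem_Ico hp _).1, ih,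
      Nat.div_div_eq_div_mul, pow_succ']

lemma truncVal_radInv {p : ℕ} (hp : 2 ≤ p) (n m : ℕ) :
    truncVal p (radInv p n) m = n % p ^ m := by
  induction m with
  | zero => simp [truncVal, Nat.mod_one]
  | succ m ih =>
    rw [truncVal, Finset.sum_range_succ, ← truncVal, ih, rdigit_radInv hp, Nat.mod_pow_succ,
      mul_comm]

lemma truncVal_add_div {p a : ℕ} (ha : a < p) {t : ℝ} (ht : t ∈ Set.Ico (0 : ℝ) 1) (m : ℕ) :
    truncVal p ((a + t) / p) (m + 1) = a + p * truncVal p t m := by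
  rw [truncVal, Finset.sum_range_succ', rdigit_add_div_zero ha ht, truncVal, Finset.mul_sum,
    add_comm, pow_zero, mul_one]
  congr 1
  refine Finset.sum_congr rfl fun r _ => ?_
  rw [rdigit_add_div_succ (by omega) _ ht.1, pow_succ]; ring

lemma sdigit_radInv {p : ℕ} (hp : 2 ≤ p) (n : ℕ) (σ : ℝ) (r : ℕ) :
    sdigit p (radInv p n) σ r = (n + truncVal p σ (r + 1)) / p ^ r % p := by
  rw [sdigit, truncVal_radInv hp, Nat.mod_add_mod, pow_succ, Nat.mod_mul_right_div_self]

lemma sdigit_radInv_lt {p : ℕ} (hp : 2 ≤ p) (n : ℕ) (σ : ℝ) (r : ℕ) :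
    sdigit p (radInv p n) σ r < p := by
  rw [sdigit_radInv hp]; exact Nat.mod_lt _ (by omega)

/-- The Monna image of the `p`-adic sum `n + φ_p^+(σ)`, before reduction modulo one. -/
noncomputable def monnaShift (p n : ℕ) (σ : ℝ) : ℝ :=
  ∑' r : ℕ, (sdigit p (radInv p n) σ r : ℝ) / (p : ℝ) ^ (r + 1)

lemma monnaShift_mem_Icc {p : ℕ} (hp : 2 ≤ p) (n : ℕ) (σ : ℝ) :
    monnaShift p n σ ∈ Set.Icc (0 : ℝ) 1 :=
  tsum_digits_mem_Icc hp (sdigit_radInv_lt hp n σ)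

lemma monnaShift_add_div {p a : ℕ} (hp : 2 ≤ p) (ha : a < p) (n : ℕ) {t : ℝ}
    (ht : t ∈ Set.Ico (0 : ℝ) 1) :
    monnaShift p n ((a + t) / p) =
      (((a + n) % p : ℕ) + monnaShift p ((a + n) / p) t) / p := by
  rw [monnaShift, tsum_digits_succ hp (sdigit_radInv_lt hp n _), monnaShift]
  congr 2
  · rw [sdigit_radInv hp, truncVal_add_div ha ht]
    simp [truncVal, add_comm]
  · refine tsum_congr fun r => ?_
    rw [sdigit_radInv hp, sdigit_radInv hp, truncVal_add_div ha ht, pow_succ',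
      ← Nat.div_div_eq_div_mul]
    congr 4
    rw [← Nat.add_mul_div_left _ _ (by omega : 0 < p)]
    congr 1
    ring

lemma exists_eq_add_div {p : ℕ} (hp : 0 < p) {σ : ℝ} (hσ : σ ∈ Set.Ico (0 : ℝ) 1) :
    ∃ a < p, ∃ t ∈ Set.Ico (0 : ℝ) 1, σ = (a + t) / p := by
  have hp' : (0 : ℝ) < p := by positivity
  have h0 : 0 ≤ σ * p := mul_nonneg hσ.1 hp'.le
  refine ⟨⌊σ * p⌋₊, ?_, σ * p - ⌊σ * p⌋₊, ⟨?_, ?_⟩, ?_⟩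
  · rw [Nat.floor_lt h0]; nlinarith [hσ.2]
  · linarith [Nat.floor_le h0]
  · linarith [Nat.lt_floor_add_one (σ * p)]
  · field_simp; ring

/-- A bounded function whose sup norm is at most a half of itself vanishes. -/
lemma eq_zero_of_bound_halves {α : Type*} {f : α → ℝ} {C : ℝ} (hC : ∀ x, |f x| ≤ C)
    (h : ∀ B, (∀ x, |f x| ≤ B) → ∀ x, |f x| ≤ B / 2) (x : α) : f x = 0 := by
  have key : ∀ k : ℕ, ∀ x, |f x| ≤ C * (1 / 2) ^ k := by
    intro k
    induction k with
    | zero => simpa using hC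
    | succ k ih => intro x; refine (h _ ih x).trans_eq ?_; rw [pow_succ]; ring
  have hlim : Filter.Tendsto (fun k : ℕ => C * (1 / 2 : ℝ) ^ k) Filter.atTop (nhds 0) := by
    simpa using (tendsto_pow_atTop_nhds_zero_of_lt_one (r := (1 / 2 : ℝ)) (by norm_num)
      (by norm_num)).const_mul C
  exact abs_nonpos_iff.1 (ge_of_tendsto' hlim fun k => key k x)

lemma monnaShift_zero {p : ℕ} (hp : 2 ≤ p) {σ : ℝ} (hσ : σ ∈ Set.Ico (0 : ℝ) 1) :
    monnaShift p 0 σ = σ := by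
  have hp' : (2 : ℝ) ≤ p := by exact_mod_cast hp
  refine sub_eq_zero.1 (eq_zero_of_bound_halves
    (f := fun σ : Set.Ico (0 : ℝ) 1 => monnaShift p 0 σ - σ) (C := 1) ?_ ?_ ⟨σ, hσ⟩)
  · rintro ⟨x, hx⟩
    have := monnaShift_mem_Icc hp 0 x
    exact abs_le.2 ⟨by linarith [this.1, hx.2], by linarith [this.2, hx.1]⟩
  · rintro B hB ⟨x, hx⟩
    obtain ⟨a, ha, t, ht, rfl⟩ := exists_eq_add_div (by omega : 0 < p) hx
    have h1 := hB ⟨t, ht⟩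
    have h2 : monnaShift p 0 ((a + t) / p) - (a + t) / p = (monnaShift p 0 t - t) / p := by
      rw [monnaShift_add_div hp ha _ ht, add_zero, Nat.mod_eq_of_lt ha, Nat.div_eq_of_lt ha]
      ring
    simp only at h1 ⊢
    rw [h2, abs_div, Nat.abs_cast]
    have := abs_nonneg (monnaShift p 0 t - t)
    exact div_le_div₀ (by linarith) h1 (by norm_num) hp'

lemma monnaShift_lt_one {p : ℕ} (hp : 2 ≤ p) (n : ℕ) {σ : ℝ} (hσ : σ ∈ Set.Ico (0 : ℝ) 1) :
    monnaShift p n σ < 1 := by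
  induction n using Nat.strong_induction_on generalizing σ with
  | _ n ih =>
    rcases Nat.eq_zero_or_pos n with rfl | hn
    · rw [monnaShift_zero hp hσ]; exact hσ.2
    obtain ⟨a, ha, t, ht, rfl⟩ := exists_eq_add_div (by omega : 0 < p) hσ
    have hp' : (0 : ℝ) < p := by positivity
    rw [monnaShift_add_div hp ha _ ht, div_lt_one hp']
    have hmod : (a + n) % p < p := Nat.mod_lt _ (by omega)
    rcases Nat.lt_or_ge ((a + n) % p + 1) p with hlt | hge
    · have : (((a + n) % p : ℕ) : ℝ) + 1 < p := by exact_mod_cast hlt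
      linarith [(monnaShift_mem_Icc hp ((a + n) / p) t).2]
    · have hq : (a + n) / p < n := by
        have h1 := Nat.mod_add_div (a + n) p
        have h2 : 2 * ((a + n) / p) ≤ p * ((a + n) / p) := Nat.mul_le_mul_right _ hp
        omega
      have : (((a + n) % p : ℕ) : ℝ) + 1 ≤ p := by exact_mod_cast hmod
      linarith [ih _ hq ht]

lemma pshift_radInv {p : ℕ} (hp : 2 ≤ p) (n : ℕ) {σ : ℝ} (hσ : σ ∈ Set.Ico (0 : ℝ) 1) :
    pshift p (radInv p n) σ = monnaShift p n σ :=
  Int.fract_eq_self.2 ⟨(monnaShift_mem_Icc hp n σ).1, monnaShift_lt_one hp n hσ⟩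

lemma measurable_monnaShift {p : ℕ} (hp : 2 ≤ p) (n : ℕ) : Measurable (monnaShift p n) := by
  have hr : ∀ r, Measurable fun σ => rdigit p σ r := fun r => by
    have h1 : Measurable fun σ : ℝ => ⌊σ * (p : ℝ) ^ (r + 1)⌋ :=
      Int.measurable_floor.comp (measurable_id.mul_const _)
    exact (measurable_from_top (f := fun z : ℤ => z.toNat % p)).comp h1
  have htr : ∀ m, Measurable fun σ => truncVal p σ m := fun m =>
    Finset.measurable_sum _ fun r _ => (hr r).mul_const _
  have hs : ∀ r, Measurable fun σ => (sdigit p (radInv p n) σ r : ℝ) / (p : ℝ) ^ (r + 1) :=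
    fun r => by
      have : Measurable fun σ => sdigit p (radInv p n) σ r :=
        (measurable_from_top
          (f := fun v : ℕ => (truncVal p (radInv p n) (r + 1) + v) % p ^ (r + 1) / p ^ r)).comp
          (htr (r + 1))
      exact (measurable_from_top (f := fun v : ℕ => (v : ℝ) / (p : ℝ) ^ (r + 1))).comp this
  refine measurable_of_tendsto_metrizable
    (f := fun m σ => ∑ r ∈ Finset.range m, (sdigit p (radInv p n) σ r : ℝ) / (p : ℝ) ^ (r + 1))
    (fun m => Finset.measurable_sum _ fun r _ => hs r) ?_
  rw [tendsto_pi_nhds]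
  intro σ
  exact (summable_digits hp (sdigit_radInv_lt hp n σ)).hasSum.tendsto_sum_nat

lemma setIntegral_Ico_eq_sum {p : ℕ} (hp : 0 < p) {f : ℝ → ℝ} (hf : Measurable f) {C : ℝ}
    (hC : ∀ x, |f x| ≤ C) :
    ∫ t in Set.Ico (0 : ℝ) 1, f t =
      (∑ a ∈ Finset.range p, ∫ t in Set.Ico (0 : ℝ) 1, f ((a + t) / p)) / p := by
  have hp' : (p : ℝ) ≠ 0 := by positivity
  have hI : ∀ g : ℝ → ℝ, ∫ t in Set.Ico (0 : ℝ) 1, g t = ∫ t in (0 : ℝ)..1, g t := fun g => by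
    rw [intervalIntegral.integral_of_le zero_le_one, integral_Ico_eq_integral_Ioc]
  have hcomp : ∀ a b : ℝ, IntervalIntegrable (fun x => f (x / p)) volume a b := fun a b =>
    (intervalIntegrable_const (c := C)).mono_fun
      (hf.comp (measurable_id.div_const _)).aestronglyMeasurable
      (Filter.Eventually.of_forall fun x => by
        simpa using (hC (x / p)).trans (le_abs_self C))
  have hsum : ∀ a ∈ Finset.range p, ∫ t in Set.Ico (0 : ℝ) 1, f ((a + t) / p) =
      ∫ x in (a : ℝ)..((a + 1 : ℕ) : ℝ), f (x / p) := fun a _ => by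
    rw [hI, intervalIntegral.integral_comp_add_left (fun x => f (x / p)) (a : ℝ)]
    simp
  rw [Finset.sum_congr rfl hsum, intervalIntegral.sum_integral_adjacent_intervals
    (a := fun k : ℕ => (k : ℝ)) (fun k _ => hcomp _ _), intervalIntegral.integral_comp_div _ hp', hI]
  simp [hp']

lemma sum_range_emod_add_mul {p : ℕ} (hp : 0 < p) (z : ℤ) {w : ℤ} (hw : IsCoprime w (p : ℤ))
    (f : ℤ → ℝ) :
    ∑ t ∈ Finset.range p, f ((z + w * t) % p) = ∑ a ∈ Finset.range p, f a := by
  have hp' : (0 : ℤ) < p := by exact_mod_cast hp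
  have hcast : ∀ t : ℕ, ((((z + w * t) % p).toNat : ℕ) : ℤ) = (z + w * t) % p := fun t =>
    Int.toNat_of_nonneg (Int.emod_nonneg _ hp'.ne')
  have hmaps : Set.MapsTo (fun t : ℕ => ((z + w * t) % p).toNat) (Finset.range p)
      (Finset.range p) := fun t _ => by
    have := Int.emod_lt_of_pos (z + w * t) hp'
    have h2 := hcast t
    simp only [Finset.coe_range, Set.mem_Iio]
    omega
  have hinj : Set.InjOn (fun t : ℕ => ((z + w * t) % p).toNat) (Finset.range p) := by
    intro t ht t' ht' h
    simp only [Finset.coe_range, Set.mem_Iio] at ht ht' h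
    have h1 : (z + w * t) % p = (z + w * t') % p :=
      (hcast t).symm.trans ((congrArg Nat.cast h).trans (hcast t'))
    have h2 : (p : ℤ) ∣ w * ((t' : ℤ) - t) := by
      have := Int.ModEq.dvd h1
      convert this using 1; ring
    have h3 : (p : ℤ) ∣ (t' : ℤ) - t := hw.symm.dvd_of_dvd_mul_left h2
    have h4 := Int.eq_zero_of_abs_lt_dvd h3 (by rw [abs_lt]; omega)
    omega
  refine Finset.sum_nbij (fun t : ℕ => ((z + w * t) % p).toNat) (fun t ht => hmaps ht) hinj
    (Finset.surjOn_of_injOn_of_card_le _ hmaps hinj le_rfl) fun t _ => ?_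
  rw [hcast]

lemma sum_range_add_mod {p : ℕ} (hp : 0 < p) (n : ℕ) (f : ℕ → ℝ) :
    ∑ a ∈ Finset.range p, f ((a + n) % p) = ∑ a ∈ Finset.range p, f a := by
  have := sum_range_emod_add_mul hp (n : ℤ) (isCoprime_one_left (x := (p : ℤ)))
    (fun z => f z.toNat)
  simp only [Int.toNat_natCast] at this
  rw [← this]
  refine Finset.sum_congr rfl fun a _ => ?_
  congr 1
  rw [one_mul, add_comm a n]
  norm_cast

/-- Half the expected distance between the Monna images of `z + k` and `z` for uniform
`z ∈ ℤ_p`. -/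
noncomputable def shiftDist (p : ℕ) (k : ℤ) : ℝ :=
  ((k / (p : ℤ) ^ padicValInt p k % p : ℤ) : ℝ) *
    ((p : ℝ) - ((k / (p : ℤ) ^ padicValInt p k % p : ℤ) : ℝ)) / (p : ℝ) ^ (padicValInt p k + 2)

lemma shiftDist_of_not_dvd {p : ℕ} {k : ℤ} (hk : ¬ (p : ℤ) ∣ k) :
    shiftDist p k = ((k % p : ℤ) : ℝ) * ((p : ℝ) - ((k % p : ℤ) : ℝ)) / (p : ℝ) ^ 2 := by
  have : padicValInt p k = 0 := padicValInt.eq_zero_of_not_dvd hk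
  rw [shiftDist, this]; simp

lemma shiftDist_zero (p : ℕ) : shiftDist p 0 = 0 := by simp [shiftDist]

lemma shiftDist_mul {p : ℕ} (hp : p.Prime) (k : ℤ) :
    shiftDist p (p * k) = shiftDist p k / p := by
  have : Fact p.Prime := ⟨hp⟩
  have hp0 : (p : ℤ) ≠ 0 := by exact_mod_cast hp.ne_zero
  rcases eq_or_ne k 0 with rfl | hk
  · simp [shiftDist_zero]
  have hv : padicValInt p (p * k) = padicValInt p k + 1 := by
    rw [padicValInt.mul hp0 hk, padicValInt_self, add_comm]
  rw [shiftDist, hv, shiftDist, pow_succ' (p : ℤ), Int.mul_ediv_mul_of_pos _ _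
    (by exact_mod_cast hp.pos), div_div]
  congr 1

lemma shiftDist_mem_Icc {p : ℕ} (hp : p.Prime) (k : ℤ) :
    shiftDist p k ∈ Set.Icc (0 : ℝ) (1 / 4) := by
  have hp0 : (0 : ℤ) < p := by exact_mod_cast hp.pos
  have hpr : (1 : ℝ) ≤ p := by exact_mod_cast hp.one_lt.le
  have h0 := Int.emod_nonneg (k / (p : ℤ) ^ padicValInt p k) hp0.ne'
  have h1 := Int.emod_lt_of_pos (k / (p : ℤ) ^ padicValInt p k) hp0
  rw [shiftDist]
  generalize k / (p : ℤ) ^ padicValInt p k % p = u at *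
  have h0' : (0 : ℝ) ≤ u := by exact_mod_cast h0
  have h1' : (u : ℝ) ≤ p := by exact_mod_cast h1.le
  refine ⟨div_nonneg (mul_nonneg h0' (by linarith)) (by positivity), ?_⟩
  rw [div_le_iff₀ (by positivity), pow_add]
  have h2 : (1 : ℝ) ≤ (p : ℝ) ^ padicValInt p k := one_le_pow₀ hpr
  nlinarith [sq_nonneg ((p : ℝ) - 2 * u), mul_le_mul_of_nonneg_right h2 (sq_nonneg (p : ℝ))]

lemma sum_abs_rotation {p u : ℕ} (hu : u ≤ p) :
    ∑ c ∈ Finset.range p, |(((c + u) % p : ℕ) : ℝ) - c| = 2 * u * ((p : ℝ) - u) := by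
  obtain ⟨v, rfl⟩ := Nat.exists_eq_add_of_le' hu
  rw [Finset.sum_range_add]
  have h1 : ∀ c ∈ Finset.range v, |(((c + u) % (v + u) : ℕ) : ℝ) - c| = u := fun c hc => by
    rw [Nat.mod_eq_of_lt (by simp at hc; omega)]; simp
  have h2 : ∀ c ∈ Finset.range u,
      |(((v + c + u) % (v + u) : ℕ) : ℝ) - (v + c : ℕ)| = v := fun c hc => by
    have : v + c + u = c + (v + u) := by ring
    rw [this, Nat.add_mod_right, Nat.mod_eq_of_lt (by simp at hc; omega)]
    push_cast; simp
  rw [Finset.sum_congr rfl h1, Finset.sum_congr rfl h2]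
  simp; ring

lemma integrable_of_bounded {f : ℝ → ℝ} (hf : Measurable f) {C : ℝ} (hC : ∀ x, |f x| ≤ C) :
    IntegrableOn f (Set.Ico (0 : ℝ) 1) :=
  Measure.integrableOn_of_bounded (M := C) (by simp) hf.aestronglyMeasurable
    (Filter.Eventually.of_forall hC)

lemma abs_le_of_forall_Ico {f : ℝ → ℝ} {C : ℝ} (hC : ∀ x, |f x| ≤ C) :
    |∫ t in Set.Ico (0 : ℝ) 1, f t| ≤ C := by
  have := norm_setIntegral_le_of_norm_le_const (f := f) (μ := volume) (s := Set.Ico (0 : ℝ) 1)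
    (C := C) (by simp) (fun x _ => hC x)
  simpa using this

lemma abs_monnaShift_le {p : ℕ} (hp : 2 ≤ p) (n : ℕ) (σ : ℝ) : |monnaShift p n σ| ≤ 1 :=
  abs_le.2 ⟨by linarith [(monnaShift_mem_Icc hp n σ).1], (monnaShift_mem_Icc hp n σ).2⟩

lemma integrableOn_monnaShift {p : ℕ} (hp : 2 ≤ p) (n : ℕ) :
    IntegrableOn (monnaShift p n) (Set.Ico (0 : ℝ) 1) :=
  integrable_of_bounded (measurable_monnaShift hp n) (abs_monnaShift_le hp n)

lemma abs_sum_div_le {p : ℕ} (hp : 2 ≤ p) {e : ℕ → ℝ} {B : ℝ} (he : ∀ a, |e a| ≤ B) {m : ℕ}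
    (hm : 2 ≤ m) : |(∑ a ∈ Finset.range p, e a) / (p : ℝ) ^ m| ≤ B / 2 := by
  have hp' : (2 : ℝ) ≤ p := by exact_mod_cast hp
  have hB : 0 ≤ B := (abs_nonneg _).trans (he 0)
  have h1 : |∑ a ∈ Finset.range p, e a| ≤ p * B :=
    (Finset.abs_sum_le_sum_abs _ _).trans
      ((Finset.sum_le_sum fun a _ => he a).trans_eq (by simp))
  have h2 : (p : ℝ) ^ 2 ≤ (p : ℝ) ^ m := pow_le_pow_right₀ (by linarith) hm
  rw [abs_div, abs_of_pos (by positivity : (0 : ℝ) < (p : ℝ) ^ m), div_le_iff₀ (by positivity)]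
  nlinarith [mul_le_mul_of_nonneg_left h2 hB, mul_nonneg hB (by linarith : (0 : ℝ) ≤ p),
    mul_nonneg (mul_nonneg hB (by linarith : (0 : ℝ) ≤ p)) (by linarith : (0 : ℝ) ≤ (p : ℝ) - 2)]

lemma sum_range_cast (p : ℕ) : ∑ a ∈ Finset.range p, (a : ℝ) = p * (p - 1) / 2 := by
  induction p with
  | zero => simp
  | succ k ih => rw [Finset.sum_range_succ, ih]; push_cast; ring

lemma sum_range_cast_sq (p : ℕ) :
    ∑ a ∈ Finset.range p, (a : ℝ) ^ 2 = p * (p - 1) * (2 * p - 1) / 6 := by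
  induction p with
  | zero => simp
  | succ k ih => rw [Finset.sum_range_succ, ih]; push_cast; ring

lemma integral_monnaShift {p : ℕ} (hp : 2 ≤ p) (n : ℕ) :
    ∫ t in Set.Ico (0 : ℝ) 1, monnaShift p n t = 1 / 2 := by
  have hp0 : 0 < p := by omega
  have hp' : (p : ℝ) ≠ 0 := by positivity
  refine sub_eq_zero.1 (eq_zero_of_bound_halves
    (f := fun n => (∫ t in Set.Ico (0 : ℝ) 1, monnaShift p n t) - 1 / 2) (C := 2) ?_ ?_ n)
  · intro n
    have := abs_le.1 (abs_le_of_forall_Ico (abs_monnaShift_le hp n))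
    exact abs_le.2 ⟨by linarith, by linarith⟩
  · intro B hB n
    have hrec : (∫ t in Set.Ico (0 : ℝ) 1, monnaShift p n t) - 1 / 2 =
        (∑ a ∈ Finset.range p,
          ((∫ t in Set.Ico (0 : ℝ) 1, monnaShift p ((a + n) / p) t) - 1 / 2)) / (p : ℝ) ^ 2 := by
      have hterm : ∀ a ∈ Finset.range p,
          ∫ t in Set.Ico (0 : ℝ) 1, monnaShift p n ((a + t) / p) =
          ((((a + n) % p : ℕ) : ℝ) +
            ∫ t in Set.Ico (0 : ℝ) 1, monnaShift p ((a + n) / p) t) / p := fun a ha => by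
        rw [setIntegral_congr_fun measurableSet_Ico
          (fun t ht => monnaShift_add_div hp (Finset.mem_range.1 ha) n ht), integral_div,
          integral_add (by simp) (integrableOn_monnaShift hp _)]
        simp
      rw [setIntegral_Ico_eq_sum hp0 (measurable_monnaShift hp n)
        (abs_monnaShift_le hp n), Finset.sum_congr rfl hterm, ← Finset.sum_div,
        Finset.sum_add_distrib, Finset.sum_sub_distrib,
        sum_range_add_mod hp0 n (fun a => (a : ℝ)), sum_range_cast]
      simp
      field_simp
      ring
    rw [hrec]
    exact abs_sum_div_le hp (fun a => hB _) le_rfl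

lemma integral_monnaShift_sq {p : ℕ} (hp : 2 ≤ p) (n : ℕ) :
    ∫ t in Set.Ico (0 : ℝ) 1, monnaShift p n t ^ 2 = 1 / 3 := by
  have hp0 : 0 < p := by omega
  have hp' : (p : ℝ) ≠ 0 := by positivity
  have hbd : ∀ n t, |monnaShift p n t ^ 2| ≤ 1 := fun n t => by
    rw [abs_pow]; exact pow_le_one₀ (abs_nonneg _) (abs_monnaShift_le hp n t)
  have hmeas : ∀ n, Measurable fun t => monnaShift p n t ^ 2 := fun n =>
    (measurable_monnaShift hp n).pow_const 2
  refine sub_eq_zero.1 (eq_zero_of_bound_halves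
    (f := fun n => (∫ t in Set.Ico (0 : ℝ) 1, monnaShift p n t ^ 2) - 1 / 3) (C := 2) ?_ ?_ n)
  · intro n
    have := abs_le.1 (abs_le_of_forall_Ico (hbd n))
    exact abs_le.2 ⟨by linarith, by linarith⟩
  · intro B hB n
    have hrec : (∫ t in Set.Ico (0 : ℝ) 1, monnaShift p n t ^ 2) - 1 / 3 =
        (∑ a ∈ Finset.range p,
          ((∫ t in Set.Ico (0 : ℝ) 1, monnaShift p ((a + n) / p) t ^ 2) - 1 / 3)) /
            (p : ℝ) ^ 3 := by
      have hterm : ∀ a ∈ Finset.range p,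
          ∫ t in Set.Ico (0 : ℝ) 1, monnaShift p n ((a + t) / p) ^ 2 =
          ((((a + n) % p : ℕ) : ℝ) ^ 2 + (((a + n) % p : ℕ) : ℝ) +
            ∫ t in Set.Ico (0 : ℝ) 1, monnaShift p ((a + n) / p) t ^ 2) / (p : ℝ) ^ 2 :=
          fun a ha => by
        have hcongr : ∀ t ∈ Set.Ico (0 : ℝ) 1, monnaShift p n ((a + t) / p) ^ 2 =
            ((((a + n) % p : ℕ) : ℝ) ^ 2 +
              (2 * (((a + n) % p : ℕ) : ℝ)) * monnaShift p ((a + n) / p) t +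
              monnaShift p ((a + n) / p) t ^ 2) / (p : ℝ) ^ 2 := fun t ht => by
          rw [monnaShift_add_div hp (Finset.mem_range.1 ha) n ht]; ring
        rw [setIntegral_congr_fun measurableSet_Ico hcongr, integral_div,
          integral_add _ (integrable_of_bounded (hmeas _) (hbd _)),
          integral_add (by simp) ((integrableOn_monnaShift hp _).const_mul _),
          integral_const_mul, integral_monnaShift hp]
        · simp; ring
        · exact (integrable_const _).add ((integrableOn_monnaShift hp _).const_mul _)
      rw [setIntegral_Ico_eq_sum hp0 (hmeas n)
        (hbd n), Finset.sum_congr rfl hterm, ← Finset.sum_div,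
        Finset.sum_add_distrib, Finset.sum_add_distrib, Finset.sum_sub_distrib,
        sum_range_add_mod hp0 n (fun a => (a : ℝ)),
        sum_range_add_mod hp0 n (fun a => (a : ℝ) ^ 2), sum_range_cast, sum_range_cast_sq]
      simp
      field_simp
      ring
    rw [hrec]
    exact abs_sum_div_le hp (fun a => hB _) (by norm_num)

lemma integral_abs_sub_monnaShift {p : ℕ} (hp : p.Prime) (n h : ℕ) :
    ∫ t in Set.Ico (0 : ℝ) 1, |monnaShift p n t - monnaShift p h t| =
      2 * shiftDist p ((n : ℤ) - h) := by
  have hp2 := hp.two_le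
  have hp0 := hp.pos
  have hp' : (p : ℝ) ≠ 0 := by positivity
  have hbd : ∀ n h t, |(|monnaShift p n t - monnaShift p h t|)| ≤ 1 := fun n h t => by
    rw [abs_abs, abs_le]
    have h1 := monnaShift_mem_Icc hp2 n t
    have h2 := monnaShift_mem_Icc hp2 h t
    exact ⟨by linarith [h1.1, h2.2], by linarith [h1.2, h2.1]⟩
  have hmeas : ∀ n h, Measurable fun t => |monnaShift p n t - monnaShift p h t| := fun n h =>
    ((measurable_monnaShift hp2 n).sub (measurable_monnaShift hp2 h)).abs
  refine sub_eq_zero.1 (eq_zero_of_bound_halves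
    (f := fun x : ℕ × ℕ => (∫ t in Set.Ico (0 : ℝ) 1,
      |monnaShift p x.1 t - monnaShift p x.2 t|) - 2 * shiftDist p ((x.1 : ℤ) - x.2))
    (C := 2) ?_ ?_ (n, h))
  · rintro ⟨n, h⟩
    have h1 := abs_le.1 (abs_le_of_forall_Ico (hbd n h))
    have h2 := shiftDist_mem_Icc hp ((n : ℤ) - h)
    exact abs_le.2 ⟨by linarith [h2.1, h2.2], by linarith [h2.1, h2.2]⟩
  · rintro B hB ⟨n, h⟩
    have hcomp := setIntegral_Ico_eq_sum hp0 (hmeas n h) (hbd n h)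
    by_cases hdvd : (p : ℤ) ∣ (n : ℤ) - h
    · have hmod : ∀ a : ℕ, (a + n) % p = (a + h) % p := fun a =>
        Nat.ModEq.add_left a ((Nat.modEq_iff_dvd.2 hdvd).symm)
      have hterm : ∀ a ∈ Finset.range p,
          ∫ t in Set.Ico (0 : ℝ) 1,
            |monnaShift p n ((a + t) / p) - monnaShift p h ((a + t) / p)| =
          (∫ t in Set.Ico (0 : ℝ) 1,
            |monnaShift p ((a + n) / p) t - monnaShift p ((a + h) / p) t|) / p := fun a ha => by
        rw [← integral_div]
        refine setIntegral_congr_fun measurableSet_Ico fun t ht => ?_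
        have ha' := Finset.mem_range.1 ha
        rw [monnaShift_add_div hp2 ha' n ht, monnaShift_add_div hp2 ha' h ht, hmod, ← sub_div,
          abs_div, Nat.abs_cast]
        congr 2; ring
      have hquot : ∀ a : ℕ, shiftDist p ((n : ℤ) - h) =
          shiftDist p ((((a + n) / p : ℕ) : ℤ) - ((a + h) / p : ℕ)) / p := fun a => by
        rw [← shiftDist_mul hp]
        congr 1
        have h1 := Nat.mod_add_div (a + n) p
        have h2 := Nat.mod_add_div (a + h) p
        have h3 := hmod a
        zify at h1 h2 h3
        push_cast
        linarith
      have hrec : (∫ t in Set.Ico (0 : ℝ) 1, |monnaShift p n t - monnaShift p h t|)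
            - 2 * shiftDist p ((n : ℤ) - h) =
          (∑ a ∈ Finset.range p, ((∫ t in Set.Ico (0 : ℝ) 1,
            |monnaShift p ((a + n) / p) t - monnaShift p ((a + h) / p) t|) -
              2 * shiftDist p ((((a + n) / p : ℕ) : ℤ) - ((a + h) / p : ℕ)))) / (p : ℝ) ^ 2 := by
        have hs : ∑ a ∈ Finset.range p,
            2 * shiftDist p ((((a + n) / p : ℕ) : ℤ) - ((a + h) / p : ℕ)) =
            2 * shiftDist p ((n : ℤ) - h) * (p : ℝ) ^ 2 := by
          rw [Finset.sum_congr rfl (g := fun _ => 2 * shiftDist p ((n : ℤ) - h) * p)]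
          · simp; ring
          · intro a _
            rw [hquot a]; field_simp
        rw [hcomp, Finset.sum_congr rfl hterm, Finset.sum_sub_distrib, hs, ← Finset.sum_div]
        field_simp
      simp only
      rw [hrec]
      exact abs_sum_div_le hp2 (fun a => hB (_, _)) le_rfl
    · have hterm : ∀ a ∈ Finset.range p,
          ∫ t in Set.Ico (0 : ℝ) 1,
            |monnaShift p n ((a + t) / p) - monnaShift p h ((a + t) / p)| =
          |(((a + n) % p : ℕ) : ℝ) - ((a + h) % p : ℕ)| / p := fun a ha => by
        have ha' := Finset.mem_range.1 ha
        have hne : (a + n) % p ≠ (a + h) % p := fun heq => hdvd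
          (Nat.modEq_iff_dvd.1 (Nat.ModEq.add_left_cancel' a heq).symm)
        have hcongr : ∀ t ∈ Set.Ico (0 : ℝ) 1,
            |monnaShift p n ((a + t) / p) - monnaShift p h ((a + t) / p)| =
            |((((a + n) % p : ℕ) : ℝ) - ((a + h) % p : ℕ)) +
              (monnaShift p ((a + n) / p) t - monnaShift p ((a + h) / p) t)| / p :=
            fun t ht => by
          rw [monnaShift_add_div hp2 ha' n ht, monnaShift_add_div hp2 ha' h ht, ← sub_div,
            abs_div, Nat.abs_cast]
          congr 2; ring
        have hX : ∀ t, |monnaShift p ((a + n) / p) t - monnaShift p ((a + h) / p) t| ≤ 1 :=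
          fun t => by simpa using hbd ((a + n) / p) ((a + h) / p) t
        have hXint : IntegrableOn (fun t => monnaShift p ((a + n) / p) t -
            monnaShift p ((a + h) / p) t) (Set.Ico (0 : ℝ) 1) :=
          (integrableOn_monnaShift hp2 _).sub (integrableOn_monnaShift hp2 _)
        have hX0 : ∫ t in Set.Ico (0 : ℝ) 1, (monnaShift p ((a + n) / p) t -
            monnaShift p ((a + h) / p) t) = 0 := by
          rw [integral_sub (integrableOn_monnaShift hp2 _) (integrableOn_monnaShift hp2 _),
            integral_monnaShift hp2, integral_monnaShift hp2, sub_self]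
        rw [setIntegral_congr_fun measurableSet_Ico hcongr, integral_div]
        congr 1
        rcases lt_or_gt_of_ne hne with hlt | hgt
        · have hlt' : (((a + n) % p : ℕ) : ℝ) + 1 ≤ ((a + h) % p : ℕ) := by exact_mod_cast hlt
          have : ∀ t ∈ Set.Ico (0 : ℝ) 1, |((((a + n) % p : ℕ) : ℝ) - ((a + h) % p : ℕ)) +
              (monnaShift p ((a + n) / p) t - monnaShift p ((a + h) / p) t)| =
              ((((a + h) % p : ℕ) : ℝ) - ((a + n) % p : ℕ)) -
              (monnaShift p ((a + n) / p) t - monnaShift p ((a + h) / p) t) := fun t _ => by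
            rw [abs_of_nonpos (by linarith [(abs_le.1 (hX t)).2])]; ring
          rw [setIntegral_congr_fun measurableSet_Ico this, integral_sub (by simp) hXint, hX0,
            abs_of_nonpos (by linarith)]
          simp
        · have hgt' : (((a + h) % p : ℕ) : ℝ) + 1 ≤ ((a + n) % p : ℕ) := by exact_mod_cast hgt
          have : ∀ t ∈ Set.Ico (0 : ℝ) 1, |((((a + n) % p : ℕ) : ℝ) - ((a + h) % p : ℕ)) +
              (monnaShift p ((a + n) / p) t - monnaShift p ((a + h) / p) t)| =
              ((((a + n) % p : ℕ) : ℝ) - ((a + h) % p : ℕ)) +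
              (monnaShift p ((a + n) / p) t - monnaShift p ((a + h) / p) t) := fun t _ =>
            abs_of_nonneg (by linarith [(abs_le.1 (hX t)).1])
          rw [setIntegral_congr_fun measurableSet_Ico this, integral_add (by simp) hXint, hX0,
            abs_of_nonneg (by linarith)]
          simp
      obtain ⟨u, hu⟩ := Int.eq_ofNat_of_zero_le
        (Int.emod_nonneg ((n : ℤ) - h) (by exact_mod_cast hp.ne_zero : (p : ℤ) ≠ 0))
      have hup : u ≤ p := by
        have := Int.emod_lt_of_pos ((n : ℤ) - h) (by exact_mod_cast hp0 : (0 : ℤ) < p)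
        omega
      have hsum : ∑ a ∈ Finset.range p, |(((a + n) % p : ℕ) : ℝ) - ((a + h) % p : ℕ)| =
          2 * u * ((p : ℝ) - u) := by
        rw [← sum_abs_rotation hup, ← sum_range_add_mod hp0 h
          (fun c => |(((c + u) % p : ℕ) : ℝ) - c|)]
        refine Finset.sum_congr rfl fun a _ => ?_
        congr 3
        zify
        rw [← hu, Int.emod_add_emod, Int.add_emod_emod]
        congr 1; ring
      have hzero : (∫ t in Set.Ico (0 : ℝ) 1, |monnaShift p n t - monnaShift p h t|)
            - 2 * shiftDist p ((n : ℤ) - h) = 0 := by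
        rw [hcomp, Finset.sum_congr rfl hterm, ← Finset.sum_div, hsum, shiftDist_of_not_dvd hdvd,
          hu]
        push_cast
        field_simp
        ring
      simp only
      rw [hzero, abs_zero]
      linarith [(abs_nonneg _).trans (hB (0, 0))]

lemma integral_min_monnaShift {p : ℕ} (hp : p.Prime) (c : ℝ) (n h : ℕ) :
    ∫ t in Set.Ico (0 : ℝ) 1, (1 + c * min (1 - monnaShift p n t) (1 - monnaShift p h t)) =
      1 + c * (1 / 2 - shiftDist p ((n : ℤ) - h)) := by
  have hn := integrableOn_monnaShift hp.two_le n
  have hh := integrableOn_monnaShift hp.two_le h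
  have hcongr : ∀ t ∈ Set.Ico (0 : ℝ) 1,
      1 + c * min (1 - monnaShift p n t) (1 - monnaShift p h t) =
      (1 + c) - c / 2 * (monnaShift p n t + monnaShift p h t +
        |monnaShift p n t - monnaShift p h t|) := fun t _ => by
    rw [min_sub_sub_left, max_def]
    split_ifs with hle
    · rw [abs_of_nonpos (by linarith)]; ring
    · rw [abs_of_nonneg (by linarith)]; ring
  have habs : IntegrableOn (fun t => |monnaShift p n t - monnaShift p h t|)
      (Set.Ico (0 : ℝ) 1) := (hn.sub hh).abs
  have hadd : IntegrableOn (fun t => monnaShift p n t + monnaShift p h t) (Set.Ico (0 : ℝ) 1) :=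
    hn.add hh
  have hadd' : IntegrableOn (fun t => monnaShift p n t + monnaShift p h t +
      |monnaShift p n t - monnaShift p h t|) (Set.Ico (0 : ℝ) 1) := hadd.add habs
  rw [setIntegral_congr_fun measurableSet_Ico hcongr, integral_sub (by simp)
    (hadd'.const_mul _), integral_const_mul, integral_add hadd habs,
    integral_add hn hh, integral_abs_sub_monnaShift hp, integral_monnaShift hp.two_le,
    integral_monnaShift hp.two_le]
  simp
  ring

lemma integral_one_sub_sq_monnaShift {p : ℕ} (hp : 2 ≤ p) (c : ℝ) (n : ℕ) :
    ∫ t in Set.Ico (0 : ℝ) 1, (1 + c / 2 * (1 - monnaShift p n t ^ 2)) = 1 + c / 3 := by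
  have hcongr : ∀ t ∈ Set.Ico (0 : ℝ) 1, 1 + c / 2 * (1 - monnaShift p n t ^ 2) =
      (1 + c / 2) - c / 2 * monnaShift p n t ^ 2 := fun t _ => by ring
  have hsq : IntegrableOn (fun t => monnaShift p n t ^ 2) (Set.Ico (0 : ℝ) 1) :=
    integrable_of_bounded ((measurable_monnaShift hp n).pow_const 2) (C := 1) fun t => by
      rw [abs_pow]; exact pow_le_one₀ (abs_nonneg _) (abs_monnaShift_le hp n t)
  rw [setIntegral_congr_fun measurableSet_Ico hcongr, integral_sub (by simp)
    (hsq.const_mul _), integral_const_mul, integral_monnaShift_sq hp]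
  simp
  ring

lemma integral_sqErr_pshift {s N : ℕ} (hN : 0 < N) {p : Fin s → ℕ} (hp : ∀ j, (p j).Prime)
    (γ : ℕ → ℝ) :
    (∫ σ in (Set.univ.pi fun _ : Fin s => Set.Ico (0 : ℝ) 1),
        sqErr s N γ fun n j => pshift (p j) (radInv (p j) n.val) (σ j)) =
      1 / (N : ℝ) ^ 2 * ∑ n ∈ Finset.range N, ∑ h ∈ Finset.range N,
        ∏ j : Fin s, (1 + γ j * (1 / 2 - shiftDist (p j) ((n : ℤ) - h))) -
      ∏ j : Fin s, (1 + γ j / 3) := by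
  have hN' : (N : ℝ) ≠ 0 := by positivity
  have hmeas : MeasurableSet (Set.univ.pi fun _ : Fin s => Set.Ico (0 : ℝ) 1) :=
    MeasurableSet.univ_pi fun _ => measurableSet_Ico
  have hcongr : ∀ σ ∈ (Set.univ.pi fun _ : Fin s => Set.Ico (0 : ℝ) 1),
      (sqErr s N γ fun n j => pshift (p j) (radInv (p j) n.val) (σ j)) =
        sqErr s N γ fun n j => monnaShift (p j) n.val (σ j) := fun σ hσ => by
    congr 1
    funext n j
    exact pshift_radInv (hp j).two_le _ (hσ j (Set.mem_univ j))
  rw [setIntegral_congr_fun hmeas hcongr]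
  simp only [sqErr]
  rw [volume_pi, Measure.restrict_pi_pi]
  set μ : Measure (Fin s → ℝ) :=
    Measure.pi fun _ : Fin s => (volume : Measure ℝ).restrict (Set.Ico 0 1) with hμ
  have hprob : IsProbabilityMeasure ((volume : Measure ℝ).restrict (Set.Ico 0 1)) :=
    ⟨by simp⟩
  have hI1 : ∀ n : Fin N, Integrable
      (fun σ : Fin s → ℝ => ∏ j : Fin s, (1 + γ j / 2 * (1 - monnaShift (p j) n (σ j) ^ 2))) μ :=
    fun n => Integrable.fintype_prod
      (f := fun (j : Fin s) x => 1 + γ j / 2 * (1 - monnaShift (p j) n x ^ 2)) fun j => by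
        have hsq : IntegrableOn (fun t => monnaShift (p j) n t ^ 2) (Set.Ico (0 : ℝ) 1) :=
          integrable_of_bounded ((measurable_monnaShift (hp j).two_le n).pow_const 2) (C := 1)
            fun t => by
              rw [abs_pow]
              exact pow_le_one₀ (abs_nonneg _) (abs_monnaShift_le (hp j).two_le n t)
        exact (integrable_const _).add (((integrable_const _).sub hsq).const_mul _)
  have hI2 : ∀ n h : Fin N, Integrable
      (fun σ : Fin s → ℝ => ∏ j : Fin s, (1 + γ j *
        min (1 - monnaShift (p j) n (σ j)) (1 - monnaShift (p j) h (σ j)))) μ :=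
    fun n h => Integrable.fintype_prod
      (f := fun (j : Fin s) x => 1 + γ j *
        min (1 - monnaShift (p j) n x) (1 - monnaShift (p j) h x)) fun j => by
        have hn := integrableOn_monnaShift (hp j).two_le n
        have hh := integrableOn_monnaShift (hp j).two_le h
        exact (integrable_const _).add
          ((((integrable_const _).sub hn).inf ((integrable_const _).sub hh)).const_mul _)
  have hE1 : ∀ n : Fin N,
      ∫ σ, ∏ j : Fin s, (1 + γ j / 2 * (1 - monnaShift (p j) n (σ j) ^ 2)) ∂μ =
        ∏ j : Fin s, (1 + γ j / 3) := fun n => by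
    rw [hμ, integral_fintype_prod_eq_prod
      (f := fun (j : Fin s) x => 1 + γ j / 2 * (1 - monnaShift (p j) n x ^ 2))]
    exact Finset.prod_congr rfl fun j _ => integral_one_sub_sq_monnaShift (hp j).two_le _ _
  have hE2 : ∀ n h : Fin N,
      ∫ σ, ∏ j : Fin s, (1 + γ j *
        min (1 - monnaShift (p j) n (σ j)) (1 - monnaShift (p j) h (σ j))) ∂μ =
        ∏ j : Fin s, (1 + γ j * (1 / 2 - shiftDist (p j) ((n : ℤ) - h))) := fun n h => by
    rw [hμ, integral_fintype_prod_eq_prod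
      (f := fun (j : Fin s) x => 1 + γ j *
        min (1 - monnaShift (p j) n x) (1 - monnaShift (p j) h x))]
    exact Finset.prod_congr rfl fun j _ => integral_min_monnaShift (hp j) _ _ _
  have hS1 := (integrable_finsetSum Finset.univ fun n _ => hI1 n).const_mul (2 / (N : ℝ))
  have hS2' := fun n => integrable_finsetSum Finset.univ fun h _ => hI2 n h
  have hS2 := (integrable_finsetSum Finset.univ fun n _ => hS2' n).const_mul (1 / (N : ℝ) ^ 2)
  have hS0 : Integrable (fun σ : Fin s → ℝ => ∏ j : Fin s, (1 + γ j / 3) - 2 / (N : ℝ) *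
      ∑ n : Fin N, ∏ j : Fin s, (1 + γ j / 2 * (1 - monnaShift (p j) n (σ j) ^ 2))) μ :=
    (integrable_const _).sub hS1
  rw [integral_add hS0 hS2, integral_sub (integrable_const _) hS1,
    integral_const_mul, integral_const_mul, integral_finsetSum _ fun n _ => hI1 n,
    integral_finsetSum _ fun n _ => hS2' n]
  simp only [fun n => integral_finsetSum Finset.univ fun h _ => hI2 n h, hE1, hE2,
    Finset.sum_range]
  simp
  field_simp
  ring

lemma card_filter_dvd_sub_le {D P R : ℕ} (hR : R ≤ D * P) (x : ℤ) :
    ((Finset.range R).filter fun h : ℕ => (D : ℤ) ∣ x - h).card ≤ P := by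
  have hcard : P = (Finset.range P).card := by simp
  rw [hcard]
  refine Finset.card_le_card_of_injOn (fun h => h / D) (fun h hh => ?_) ?_
  · simp only [Finset.coe_filter, Finset.mem_range, Set.mem_ofPred_eq] at hh
    simp only [Finset.coe_range, Set.mem_Iio]
    exact Nat.div_lt_of_lt_mul (by omega)
  · intro h hh h' hh' heq
    simp only [Finset.coe_filter, Finset.mem_range, Set.mem_ofPred_eq] at hh hh' heq
    have hdvd : (D : ℤ) ∣ (h' : ℤ) - h := by
      have heq' : (h' : ℤ) - h = (x - h) - (x - h') := by ring
      rw [heq']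
      exact dvd_sub hh.2 hh'.2
    have hmod : h % D = h' % D := Nat.modEq_iff_dvd.2 hdvd
    rw [← Nat.mod_add_div h D, ← Nat.mod_add_div h' D, hmod, heq]

lemma sum_sum_sub_le {D P R : ℕ} (hR : R ≤ D * P) {g : ℤ → ℝ} {C : ℝ} (hC : 0 ≤ C)
    (hg : ∀ k, |g k| ≤ if (D : ℤ) ∣ k then C else 0) :
    ∑ n ∈ Finset.range R, ∑ h ∈ Finset.range R, g ((n : ℤ) - h) ≤ R * (P * C) := by
  have hn : ∀ n ∈ Finset.range R, ∑ h ∈ Finset.range R, g ((n : ℤ) - h) ≤ P * C := fun n _ => by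
    calc ∑ h ∈ Finset.range R, g ((n : ℤ) - h)
        ≤ ∑ h ∈ Finset.range R, if (D : ℤ) ∣ (n : ℤ) - h then C else 0 :=
          Finset.sum_le_sum fun h _ => (le_abs_self _).trans (hg _)
      _ = ((Finset.range R).filter fun h : ℕ => (D : ℤ) ∣ (n : ℤ) - h).card * C := by
          rw [← Finset.sum_filter]; simp
      _ ≤ P * C := by
          gcongr
          exact card_filter_dvd_sub_le hR _
  calc _ ≤ ∑ n ∈ Finset.range R, (P * C : ℝ) := Finset.sum_le_sum hn
    _ = R * (P * C) := by simp

lemma sum_range_eq_sum_range_mod {f : ℕ → ℝ} {d : ℕ} (hf : ∀ h, f (h + d) = f h)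
    (h0 : ∑ h ∈ Finset.range d, f h = 0) (N : ℕ) :
    ∑ h ∈ Finset.range N, f h = ∑ h ∈ Finset.range (N % d), f h := by
  have hq : ∀ q r, ∑ h ∈ Finset.range (d * q + r), f h = ∑ h ∈ Finset.range r, f h := by
    intro q r
    induction q with
    | zero => simp
    | succ q ih =>
      have : d * (q + 1) + r = d + (d * q + r) := by ring
      rw [this, Finset.sum_range_add, h0, zero_add, ← ih]
      exact Finset.sum_congr rfl fun h _ => by rw [add_comm d h, hf]
  conv_lhs => rw [← Nat.div_add_mod N d]
  exact hq _ _

lemma sum_sum_sub_eq_mod {g : ℤ → ℝ} {d : ℕ} (hper : ∀ k, g (k + d) = g k)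
    (h0 : ∀ x, ∑ h ∈ Finset.range d, g (x + h) = 0) (N : ℕ) :
    ∑ n ∈ Finset.range N, ∑ h ∈ Finset.range N, g ((n : ℤ) - h) =
      ∑ n ∈ Finset.range (N % d), ∑ h ∈ Finset.range (N % d), g ((n : ℤ) - h) := by
  have hinner : ∀ n : ℕ, ∑ h ∈ Finset.range N, g ((n : ℤ) - h) =
      ∑ h ∈ Finset.range (N % d), g ((n : ℤ) - h) := fun n => by
    refine sum_range_eq_sum_range_mod (f := fun h : ℕ => g ((n : ℤ) - h)) (fun h => ?_) ?_ N
    · rw [← hper]; congr 1; push_cast; ring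
    · rw [← Finset.sum_range_reflect, ← h0 ((n : ℤ) - d + 1)]
      refine Finset.sum_congr rfl fun h hh => ?_
      have := Finset.mem_range.1 hh
      congr 1
      omega
  simp only [hinner]
  rw [Finset.sum_comm, Finset.sum_comm (s := Finset.range (N % d)) (t := Finset.range (N % d))]
  refine Finset.sum_congr rfl fun h _ => ?_
  refine sum_range_eq_sum_range_mod (f := fun n : ℕ => g ((n : ℤ) - h)) (fun n => ?_) ?_ N
  · rw [← hper ((n : ℤ) - h)]; congr 1; push_cast; ring
  · rw [← h0 (-(h : ℤ))]
    exact Finset.sum_congr rfl fun n _ => by congr 1; ring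

lemma sum_sum_sub_le_min {D P N : ℕ} (hD : 0 < D) (hP : 0 < P) {g : ℤ → ℝ} {C : ℝ} (hC : 0 ≤ C)
    (hg : ∀ k, |g k| ≤ if (D : ℤ) ∣ k then C else 0)
    (hper : D * P ≤ N → ∀ k, g (k + (D * P : ℕ)) = g k)
    (h0 : D * P ≤ N → ∀ x, ∑ h ∈ Finset.range (D * P), g (x + h) = 0) :
    ∑ n ∈ Finset.range N, ∑ h ∈ Finset.range N, g ((n : ℤ) - h) ≤
      C * P * (D * P : ℕ) * min 1 ((N : ℝ) / (D * P : ℕ)) := by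
  have hd : 0 < D * P := Nat.mul_pos hD hP
  have hd' : (0 : ℝ) < (D * P : ℕ) := by exact_mod_cast hd
  rcases le_or_gt (D * P) N with hle | hgt
  · rw [sum_sum_sub_eq_mod (hper hle) (h0 hle), min_eq_left, mul_one]
    · refine (sum_sum_sub_le (Nat.mod_lt N hd).le hC hg).trans ?_
      have : ((N % (D * P) : ℕ) : ℝ) ≤ (D * P : ℕ) := by exact_mod_cast (Nat.mod_lt N hd).le
      calc _ ≤ ((D * P : ℕ) : ℝ) * (P * C) := by gcongr
        _ = _ := by ring
    · rw [le_div_iff₀ hd', one_mul]; exact_mod_cast hle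
  · rw [min_eq_right]
    · refine (sum_sum_sub_le hgt.le hC hg).trans_eq ?_
      field_simp
    · rw [div_le_one hd']; exact_mod_cast hgt.le

lemma sum_range_mul_eq_zero {e p : ℕ} {a b : ℤ → ℝ} (hb : ∀ x t, b (x + e * t) = b x)
    (ha : ∀ x, ∑ t ∈ Finset.range p, a (x + e * t) = 0) (x : ℤ) :
    ∑ h ∈ Finset.range (e * p), a (x + h) * b (x + h) = 0 := by
  have hsplit : ∀ (F : ℕ → ℝ) (q : ℕ), ∑ h ∈ Finset.range (e * q), F h =
      ∑ t ∈ Finset.range q, ∑ h ∈ Finset.range e, F (e * t + h) := fun F q => by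
    induction q with
    | zero => simp
    | succ q ih => rw [mul_add_one, Finset.sum_range_add, ih, Finset.sum_range_succ]
  rw [hsplit, Finset.sum_comm]
  refine Finset.sum_eq_zero fun h _ => ?_
  have hterm : ∀ t ∈ Finset.range p,
      a (x + (e * t + h : ℕ)) * b (x + (e * t + h : ℕ)) = a (x + h + e * t) * b (x + h) :=
    fun t _ => by
      rw [← hb (x + h) t]
      congr 2 <;> (push_cast; ring)
  rw [Finset.sum_congr rfl hterm, ← Finset.sum_mul, ha, zero_mul]

lemma min_one_div_prod_le {ι : Type*} (S : Finset ι) {q : ι → ℕ} (hq : ∀ i, 0 < q i) {N : ℕ}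
    (hN : 0 < N) :
    min 1 ((N : ℝ) / (∏ i ∈ S, q i : ℕ)) ≤ ∏ i ∈ S, min 1 ((N : ℝ) / q i) := by
  classical
  have hN' : (1 : ℝ) ≤ N := by exact_mod_cast hN
  induction S using Finset.induction_on with
  | empty => simp
  | insert i S hi ih =>
    rw [Finset.prod_insert hi, Finset.prod_insert hi]
    refine le_trans ?_ (mul_le_mul_of_nonneg_left ih (by positivity))
    have hx : (1 : ℝ) ≤ q i := by exact_mod_cast hq i
    have hy : (1 : ℝ) ≤ (∏ i ∈ S, q i : ℕ) := by
      exact_mod_cast Finset.prod_pos fun i _ => hq i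
    push_cast at hy ⊢
    generalize (q i : ℝ) = x at *
    generalize ∏ i ∈ S, (q i : ℝ) = y at *
    have hxy : (N : ℝ) / (x * y) ≤ N / x := by
      gcongr
      nlinarith
    have hyx : (N : ℝ) / (x * y) ≤ N / y := by
      gcongr
      nlinarith
    have hxx : (N : ℝ) / (x * y) ≤ N / x * (N / y) := by
      rw [div_mul_div_comm]
      gcongr
      nlinarith
    rcases min_cases (1 : ℝ) (N / x) with ⟨h1, _⟩ | ⟨h1, _⟩ <;>
    rcases min_cases (1 : ℝ) (N / y) with ⟨h2, _⟩ | ⟨h2, _⟩ <;> rw [h1, h2]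
    · simp
    · rw [one_mul]; exact (min_le_right _ _).trans hyx
    · rw [mul_one]; exact (min_le_right _ _).trans hxy
    · exact (min_le_right _ _).trans hxx

/-- The values on residues of the increments of `1 / 6 - shiftDist p` along powers of `p`. -/
noncomputable def residueTerm (p : ℕ) (a : ℤ) : ℝ :=
  1 / 6 - (a : ℝ) * ((p : ℝ) - a) / (p : ℝ) ^ 2 - if a = 0 then 1 / (6 * (p : ℝ)) else 0

lemma abs_residueTerm_le {p : ℕ} (hp : 0 < p) {a : ℤ} (h0 : 0 ≤ a) (h1 : a < p) :
    |residueTerm p a| ≤ 1 / 6 := by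
  have hp1 : (1 : ℝ) ≤ p := by exact_mod_cast hp
  rw [residueTerm]
  split_ifs with ha
  · subst ha
    have h2 : 1 / (6 * (p : ℝ)) ≤ 1 / 6 := by
      apply one_div_le_one_div_of_le <;> linarith
    have h3 : 0 ≤ 1 / (6 * (p : ℝ)) := by positivity
    simp only [Int.cast_zero, zero_mul, zero_div, sub_zero]
    rw [abs_le]
    constructor <;> linarith
  · have h0' : (0 : ℝ) ≤ a := by exact_mod_cast h0
    have h1' : (a : ℝ) ≤ p := by exact_mod_cast h1.le
    have h2 : (a : ℝ) * ((p : ℝ) - a) / (p : ℝ) ^ 2 ≤ 1 / 4 := by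
      rw [div_le_iff₀ (by positivity)]
      nlinarith [sq_nonneg ((p : ℝ) - 2 * a)]
    have h3 : 0 ≤ (a : ℝ) * ((p : ℝ) - a) / (p : ℝ) ^ 2 :=
      div_nonneg (mul_nonneg h0' (by linarith)) (by positivity)
    rw [abs_le]
    constructor <;> linarith

lemma sum_residueTerm {p : ℕ} (hp : 0 < p) :
    ∑ a ∈ Finset.range p, residueTerm p a = 0 := by
  have hp' : (p : ℝ) ≠ 0 := by positivity
  have h : ∀ a ∈ Finset.range p, residueTerm p (a : ℕ) =
      1 / 6 - (p * (a : ℝ) - (a : ℝ) ^ 2) / (p : ℝ) ^ 2 -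
        if a = 0 then 1 / (6 * (p : ℝ)) else 0 := fun a _ => by
    simp only [residueTerm, Int.cast_natCast, Nat.cast_eq_zero]
    ring
  rw [Finset.sum_congr rfl h, Finset.sum_sub_distrib, Finset.sum_sub_distrib,
    ← Finset.sum_div _ _ ((p : ℝ) ^ 2), Finset.sum_sub_distrib, ← Finset.mul_sum,
    sum_range_cast, sum_range_cast_sq]
  simp [hp]
  field_simp
  ring

/-- `p^{-l} (1 / 6 - shiftDist p (k / p^l))`, supported on multiples of `p^l`. -/
noncomputable def shiftLevel (p l : ℕ) (k : ℤ) : ℝ :=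
  if (p : ℤ) ^ l ∣ k then (1 / 6 - shiftDist p (k / (p : ℤ) ^ l)) / (p : ℝ) ^ l else 0

/-- The telescoping pieces of `1 / 6 - shiftDist p`, cut off at level `m`. -/
noncomputable def levelTerm (p m l : ℕ) (k : ℤ) : ℝ :=
  if l < m then shiftLevel p l k - shiftLevel p (l + 1) k else shiftLevel p l k

lemma sum_levelTerm (p m : ℕ) (k : ℤ) :
    ∑ l ∈ Finset.range (m + 1), levelTerm p m l k = 1 / 6 - shiftDist p k := by
  have h : ∀ l ∈ Finset.range m, levelTerm p m l k = shiftLevel p l k - shiftLevel p (l + 1) k :=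
    fun l hl => if_pos (Finset.mem_range.1 hl)
  rw [Finset.sum_range_succ, Finset.sum_congr rfl h, Finset.sum_range_sub', levelTerm,
    if_neg (lt_irrefl _), sub_add_cancel]
  simp [shiftLevel]

lemma levelTerm_of_lt {p m l : ℕ} (hp : p.Prime) (hl : l < m) (k : ℤ) :
    levelTerm p m l k =
      if (p : ℤ) ^ l ∣ k then residueTerm p (k / (p : ℤ) ^ l % p) / (p : ℝ) ^ l else 0 := by
  have hpl : (p : ℤ) ^ l ≠ 0 := pow_ne_zero _ (by exact_mod_cast hp.ne_zero)
  have hp0 : (p : ℤ) ≠ 0 := by exact_mod_cast hp.ne_zero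
  have hpr : (p : ℝ) ≠ 0 := by exact_mod_cast hp.ne_zero
  rw [levelTerm, if_pos hl, shiftLevel, shiftLevel]
  by_cases hk : (p : ℤ) ^ l ∣ k
  · obtain ⟨j, rfl⟩ := hk
    rw [if_pos (dvd_mul_right _ _), if_pos (dvd_mul_right _ _), Int.mul_ediv_cancel_left _ hpl]
    simp only [pow_succ (p : ℤ), mul_dvd_mul_iff_left hpl]
    by_cases hj : (p : ℤ) ∣ j
    · obtain ⟨i, rfl⟩ := hj
      rw [if_pos (dvd_mul_right _ _), ← mul_assoc, Int.mul_ediv_cancel_left _ (mul_ne_zero hpl hp0),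
        shiftDist_mul hp, Int.mul_emod_right, residueTerm, if_pos rfl]
      field_simp
      push_cast
      ring
    · rw [if_neg hj, shiftDist_of_not_dvd hj, residueTerm,
        if_neg (fun h => hj (Int.dvd_of_emod_eq_zero h))]
      simp
  · rw [if_neg hk, if_neg hk, if_neg (fun h => hk ((pow_dvd_pow _ l.le_succ).trans h)), sub_zero]

lemma abs_levelTerm_le {p : ℕ} (hp : p.Prime) (m l : ℕ) (k : ℤ) :
    |levelTerm p m l k| ≤ if (p : ℤ) ^ l ∣ k then 1 / 6 / (p : ℝ) ^ l else 0 := by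
  have hp0 : (0 : ℤ) < p := by exact_mod_cast hp.pos
  have hpl : (0 : ℝ) < (p : ℝ) ^ l := pow_pos (by exact_mod_cast hp.pos) _
  by_cases hl : l < m
  · rw [levelTerm_of_lt hp hl]
    split_ifs
    · rw [abs_div, abs_of_pos hpl]
      gcongr
      exact abs_residueTerm_le hp.pos (Int.emod_nonneg _ hp0.ne') (Int.emod_lt_of_pos _ hp0)
    · simp
  · rw [levelTerm, if_neg hl, shiftLevel]
    split_ifs
    · rw [abs_div, abs_of_pos hpl]
      have := shiftDist_mem_Icc hp (k / (p : ℤ) ^ l)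
      gcongr
      rw [abs_le]
      constructor <;> linarith [this.1, this.2]
    · simp

lemma levelTerm_add_mul {p m l : ℕ} (hp : p.Prime) (hl : l < m) (k x : ℤ) :
    levelTerm p m l (k + (p : ℤ) ^ (l + 1) * x) = levelTerm p m l k := by
  have hpl : (p : ℤ) ^ l ≠ 0 := pow_ne_zero _ (by exact_mod_cast hp.ne_zero)
  rw [levelTerm_of_lt hp hl, levelTerm_of_lt hp hl, pow_succ, mul_assoc]
  simp only [dvd_add_left (dvd_mul_right ((p : ℤ) ^ l) _)]
  rw [Int.add_mul_ediv_left _ _ hpl, Int.add_mul_emod_self_left]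

lemma sum_levelTerm_add_mul {p m l : ℕ} (hp : p.Prime) (hl : l < m) (k : ℤ) {w : ℤ}
    (hw : IsCoprime w (p : ℤ)) :
    ∑ t ∈ Finset.range p, levelTerm p m l (k + (p : ℤ) ^ l * w * t) = 0 := by
  have hpl : (p : ℤ) ^ l ≠ 0 := pow_ne_zero _ (by exact_mod_cast hp.ne_zero)
  simp only [levelTerm_of_lt hp hl, mul_assoc, dvd_add_left (dvd_mul_right ((p : ℤ) ^ l) _),
    Int.add_mul_ediv_left _ _ hpl]
  split_ifs
  · rw [← Finset.sum_div, sum_range_emod_add_mul hp.pos _ hw (residueTerm p),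
      sum_residueTerm hp.pos, zero_div]
  · simp

/-- The summands in the level expansion of `1 + c * (1 / 2 - shiftDist p k)`. -/
noncomputable def levelFactor (p m : ℕ) (c : ℝ) : ℕ → ℤ → ℝ
  | 0, _ => 1 + c / 3
  | l + 1, k => c * levelTerm p m l k

/-- The uniform bound for `levelFactor`. -/
noncomputable def levelConst (p : ℕ) (c : ℝ) : ℕ → ℝ
  | 0 => 1 + c / 3
  | l + 1 => c * (1 / 6 / (p : ℝ) ^ l)

lemma levelConst_nonneg (p : ℕ) {c : ℝ} (hc : 0 ≤ c) (l : ℕ) : 0 ≤ levelConst p c l := by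
  cases l <;> (simp only [levelConst]; positivity)

lemma sum_levelFactor (p m : ℕ) (c : ℝ) (k : ℤ) :
    ∑ l ∈ Finset.range (m + 2), levelFactor p m c l k = 1 + c * (1 / 2 - shiftDist p k) := by
  rw [Finset.sum_range_succ']
  simp only [levelFactor]
  rw [← Finset.mul_sum, sum_levelTerm]
  ring

lemma abs_levelFactor_le {p : ℕ} (hp : p.Prime) (m : ℕ) {c : ℝ} (hc : 0 ≤ c) (l : ℕ) (k : ℤ) :
    |levelFactor p m c l k| ≤ if ((p ^ (l - 1) : ℕ) : ℤ) ∣ k then levelConst p c l else 0 := by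
  cases l with
  | zero =>
    simp only [levelFactor, levelConst, zero_tsub, pow_zero, Nat.cast_one, isUnit_one,
      IsUnit.dvd, if_true]
    rw [abs_of_nonneg (by positivity)]
  | succ l =>
    simp only [levelFactor, levelConst, add_tsub_cancel_right]
    rw [abs_mul, abs_of_nonneg hc]
    refine (mul_le_mul_of_nonneg_left (abs_levelTerm_le hp m l k) hc).trans_eq ?_
    push_cast
    split_ifs <;> simp

lemma levelFactor_add_of_dvd {p m : ℕ} (hp : p.Prime) (c : ℝ) {l : ℕ} (hl : l ≤ m) (k : ℤ) {y : ℤ}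
    (hy : ((p ^ l : ℕ) : ℤ) ∣ y) : levelFactor p m c l (k + y) = levelFactor p m c l k := by
  cases l with
  | zero => rfl
  | succ l =>
    obtain ⟨x, rfl⟩ := hy
    simp only [levelFactor]
    push_cast
    rw [levelTerm_add_mul hp hl]

lemma sum_sum_prod_levelFactor_le {ι : Type*} [Fintype ι] [DecidableEq ι] {p : ι → ℕ}
    (hp : ∀ i, (p i).Prime) (hinj : Function.Injective p) {c : ι → ℝ} (hc : ∀ i, 0 ≤ c i) {N : ℕ}
    (hN : 0 < N) (l : ι → ℕ) {i₀ : ι} (hi₀ : l i₀ ≠ 0) :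
    ∑ n ∈ Finset.range N, ∑ h ∈ Finset.range N,
        ∏ i, levelFactor (p i) (Nat.log (p i) N) (c i) (l i) ((n : ℤ) - h) ≤
      ∏ i, levelConst (p i) (c i) (l i) * (if l i = 0 then 1 else (p i : ℝ)) * (p i : ℝ) ^ l i *
        min 1 ((N : ℝ) / (p i : ℝ) ^ l i) := by
  set D : ℕ := ∏ i, p i ^ (l i - 1) with hD
  set P : ℕ := ∏ i, (if l i = 0 then 1 else p i) with hP
  have hDP : D * P = ∏ i, p i ^ l i := by
    rw [hD, hP, ← Finset.prod_mul_distrib]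
    refine Finset.prod_congr rfl fun i _ => ?_
    split_ifs with h
    · simp [h]
    · rw [← pow_succ, Nat.sub_add_cancel (Nat.pos_of_ne_zero h)]
  have hcop : ∀ (f : ι → ℕ) (i j : ι), i ≠ j →
      IsCoprime ((p i ^ f i : ℕ) : ℤ) ((p j ^ f j : ℕ) : ℤ) := fun f i j hij =>
    Nat.isCoprime_iff_coprime.2 (Nat.Coprime.pow _ _
      ((Nat.coprime_primes (hp i) (hp j)).2 (hinj.ne hij)))
  have hlog : D * P ≤ N → ∀ i, l i ≤ Nat.log (p i) N := fun hle i => by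
    refine Nat.le_log_of_pow_le (hp i).one_lt (le_trans ?_ hle)
    rw [hDP]
    exact Nat.le_of_dvd (Finset.prod_pos fun i _ => pow_pos (hp i).pos _)
      (Finset.dvd_prod_of_mem (fun i => p i ^ l i) (Finset.mem_univ i))
  have hmain := sum_sum_sub_le_min (D := D) (P := P) (N := N)
    (g := fun k => ∏ i, levelFactor (p i) (Nat.log (p i) N) (c i) (l i) k)
    (C := ∏ i, levelConst (p i) (c i) (l i))
    (Finset.prod_pos fun i _ => pow_pos (hp i).pos _)
    (Finset.prod_pos fun i _ => by split_ifs; exacts [one_pos, (hp i).pos])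
    (Finset.prod_nonneg fun i _ => levelConst_nonneg _ (hc i) _) ?_ ?_ ?_
  · refine hmain.trans ?_
    have hmin := min_one_div_prod_le Finset.univ (q := fun i => p i ^ l i)
      (fun i => pow_pos (hp i).pos _) hN
    rw [hDP, Finset.prod_mul_distrib, Finset.prod_mul_distrib, Finset.prod_mul_distrib]
    push_cast [hP] at hmin ⊢
    refine mul_le_mul_of_nonneg_left hmin ?_
    exact mul_nonneg (mul_nonneg (Finset.prod_nonneg fun i _ => levelConst_nonneg _ (hc i) _)
      (Finset.prod_nonneg fun i _ => by split_ifs <;> positivity))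
      (Finset.prod_nonneg fun i _ => by positivity)
  · intro k
    rw [Finset.abs_prod]
    split_ifs with hk
    · refine Finset.prod_le_prod (fun i _ => abs_nonneg _) fun i _ => ?_
      refine (abs_levelFactor_le (hp i) _ (hc i) _ _).trans_eq (if_pos (dvd_trans ?_ hk))
      exact_mod_cast Finset.dvd_prod_of_mem (fun i => p i ^ (l i - 1)) (Finset.mem_univ i)
    · obtain ⟨i, hi⟩ : ∃ i, ¬ ((p i ^ (l i - 1) : ℕ) : ℤ) ∣ k := by
        by_contra! hall
        refine hk ?_
        rw [hD, Nat.cast_prod]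
        exact Finset.prod_dvd_of_coprime
          (fun i _ j _ hij => hcop (fun i => l i - 1) i j hij) fun i _ => hall i
      refine (Finset.prod_eq_zero (Finset.mem_univ i) ?_).le
      have := abs_levelFactor_le (hp i) (Nat.log (p i) N) (hc i) (l i) k
      rw [if_neg hi] at this
      exact le_antisymm this (abs_nonneg _)
  · intro hle k
    refine Finset.prod_congr rfl fun i _ => levelFactor_add_of_dvd (hp i) _ (hlog hle i) _ ?_
    rw [hDP]
    exact_mod_cast Finset.dvd_prod_of_mem (fun i => p i ^ l i) (Finset.mem_univ i)
  · intro hle x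
    obtain ⟨l', hl'⟩ := Nat.exists_eq_succ_of_ne_zero hi₀
    set w : ℕ := ∏ j ∈ Finset.univ.erase i₀, p j ^ l j with hw
    have hlt : l' < Nat.log (p i₀) N := by
      have := hlog hle i₀
      omega
    have he : D * P = p i₀ ^ l' * w * p i₀ := by
      rw [hDP, ← Finset.mul_prod_erase _ _ (Finset.mem_univ i₀), hl', pow_succ]
      ring
    have hwc : IsCoprime (w : ℤ) (p i₀ : ℤ) := by
      rw [hw, Nat.cast_prod]
      refine IsCoprime.prod_left fun j hj => ?_
      have := hcop (fun i => if i = i₀ then 1 else l i) j i₀ (Finset.ne_of_mem_erase hj)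
      simpa [Finset.ne_of_mem_erase hj] using this
    rw [he]
    simp only [← Finset.mul_prod_erase _ _ (Finset.mem_univ i₀)]
    refine sum_range_mul_eq_zero
      (a := levelFactor (p i₀) (Nat.log (p i₀) N) (c i₀) (l i₀))
      (b := fun k => ∏ j ∈ Finset.univ.erase i₀,
        levelFactor (p j) (Nat.log (p j) N) (c j) (l j) k) (fun y t => ?_) (fun y => ?_) x
    · refine Finset.prod_congr rfl fun j hj => levelFactor_add_of_dvd (hp j) _ (hlog hle j) _ ?_
      refine Dvd.dvd.mul_right ?_ t
      exact_mod_cast (Finset.dvd_prod_of_mem (fun j => p j ^ l j) hj).mul_left _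
    · simp only [hl', levelFactor]
      rw [← Finset.mul_sum]
      push_cast
      rw [sum_levelTerm_add_mul (hp i₀) hlt y hwc, mul_zero]

lemma sum_sum_prod_shiftDist_le {ι : Type*} [Fintype ι] [DecidableEq ι] {p : ι → ℕ}
    (hp : ∀ i, (p i).Prime) (hinj : Function.Injective p) {c : ι → ℝ} (hc : ∀ i, 0 ≤ c i) {N : ℕ}
    (hN : 0 < N) :
    ∑ n ∈ Finset.range N, ∑ h ∈ Finset.range N,
        ∏ i, (1 + c i * (1 / 2 - shiftDist (p i) ((n : ℤ) - h))) ≤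
      (N : ℝ) ^ 2 * ∏ i, (1 + c i / 3) +
        ∏ i, ∑ l ∈ Finset.range (Nat.log (p i) N + 2),
          levelConst (p i) (c i) l * (if l = 0 then 1 else (p i : ℝ)) * (p i : ℝ) ^ l *
            min 1 ((N : ℝ) / (p i : ℝ) ^ l) := by
  set T : Finset (ι → ℕ) := Fintype.piFinset fun i => Finset.range (Nat.log (p i) N + 2) with hT
  have hexp : ∀ k : ℤ, ∏ i, (1 + c i * (1 / 2 - shiftDist (p i) k)) =
      ∑ l ∈ T, ∏ i, levelFactor (p i) (Nat.log (p i) N) (c i) (l i) k := fun k => by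
    rw [hT, ← Finset.prod_univ_sum (fun i => Finset.range (Nat.log (p i) N + 2))
      fun i l => levelFactor (p i) (Nat.log (p i) N) (c i) l k]
    exact Finset.prod_congr rfl fun i _ => (sum_levelFactor _ _ _ _).symm
  have hzero : (0 : ι → ℕ) ∈ T := by simp [hT]
  rw [Finset.prod_univ_sum, ← hT]
  simp only [hexp]
  have hswap : ∑ n ∈ Finset.range N, ∑ h ∈ Finset.range N, ∑ l ∈ T,
      ∏ i, levelFactor (p i) (Nat.log (p i) N) (c i) (l i) ((n : ℤ) - h) =
      ∑ l ∈ T, ∑ n ∈ Finset.range N, ∑ h ∈ Finset.range N,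
        ∏ i, levelFactor (p i) (Nat.log (p i) N) (c i) (l i) ((n : ℤ) - h) :=
    (Finset.sum_congr rfl fun n _ => Finset.sum_comm).trans Finset.sum_comm
  rw [hswap]
  have hterm : ∀ l ∈ T, ∑ n ∈ Finset.range N, ∑ h ∈ Finset.range N,
        ∏ i, levelFactor (p i) (Nat.log (p i) N) (c i) (l i) ((n : ℤ) - h) ≤
      (if l = 0 then (N : ℝ) ^ 2 * ∏ i, (1 + c i / 3) else 0) +
        ∏ i, levelConst (p i) (c i) (l i) * (if l i = 0 then 1 else (p i : ℝ)) *
          (p i : ℝ) ^ l i * min 1 ((N : ℝ) / (p i : ℝ) ^ l i) := fun l _ => by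
    split_ifs with hl
    · refine le_add_of_le_of_nonneg (le_of_eq ?_) (Finset.prod_nonneg fun i _ => ?_)
      · simp [hl, levelFactor]
        ring
      · have := levelConst_nonneg (p i) (hc i) (l i)
        split_ifs <;> positivity
    · obtain ⟨i₀, hi₀⟩ := Function.ne_iff.1 hl
      rw [zero_add]
      exact sum_sum_prod_levelFactor_le hp hinj hc hN l hi₀
  refine (Finset.sum_le_sum hterm).trans_eq ?_
  rw [Finset.sum_add_distrib, Finset.sum_ite_eq' T, if_pos hzero]

lemma half_le_log {N : ℕ} (hN : 2 ≤ N) : 1 / 2 ≤ Real.log N := by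
  have := Real.log_two_gt_d9
  have := Real.log_le_log two_pos (Nat.ofNat_le_cast.2 hN : (2 : ℝ) ≤ N)
  linarith

lemma div_le_four_mul_log_div_log {p N : ℕ} (hN : 2 ≤ N) (hNp : N ≤ p) :
    (N : ℝ) / p ≤ 4 * (Real.log N / Real.log p) := by
  have hN' : (2 : ℝ) ≤ N := by exact_mod_cast hN
  have hNp' : (N : ℝ) ≤ p := by exact_mod_cast hNp
  have hp0 : (0 : ℝ) < p := by linarith
  have hlp : 0 < Real.log p := Real.log_pos (by linarith)
  have hlN := half_le_log hN
  have h1 : Real.log p - Real.log N ≤ p / N - 1 := by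
    rw [← Real.log_div (by positivity) (by positivity)]
    exact Real.log_le_sub_one_of_pos (by positivity)
  have h2 := mul_le_mul_of_nonneg_left h1 (by positivity : (0 : ℝ) ≤ N)
  have h3 : (N : ℝ) * (p / N - 1) = p - N := by field_simp
  rw [← mul_div_assoc, div_le_div_iff₀ hp0 hlp]
  nlinarith

lemma log_add_min_le {p N : ℕ} (hp : 2 ≤ p) (hN : 2 ≤ N) :
    (Nat.log p N : ℝ) + min 1 ((N : ℝ) / (p : ℝ) ^ (Nat.log p N + 1)) ≤
      4 * (Real.log N / Real.log p) := by
  have hp' : (2 : ℝ) ≤ p := by exact_mod_cast hp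
  have hlp : 0 < Real.log p := Real.log_pos (by linarith)
  rcases Nat.eq_zero_or_pos (Nat.log p N) with h | h
  · have hlt : N < p := (Nat.log_eq_zero_iff.1 h).resolve_right (by omega)
    rw [h, Nat.cast_zero, zero_add, zero_add, pow_one]
    exact (min_le_right _ _).trans (div_le_four_mul_log_div_log hN hlt.le)
  · have h1 : (1 : ℝ) ≤ Nat.log p N := by exact_mod_cast h
    have h2 : (Nat.log p N : ℝ) ≤ Real.log N / Real.log p := by
      rw [le_div_iff₀ hlp, ← Real.log_pow]
      refine Real.log_le_log (by positivity) ?_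
      exact_mod_cast Nat.pow_log_le_self p (by omega)
    have := min_le_left 1 ((N : ℝ) / (p : ℝ) ^ (Nat.log p N + 1))
    linarith

lemma sum_levelBound_le {p N : ℕ} (hp : 2 ≤ p) (hN : 2 ≤ N) {c : ℝ} (hc : 0 ≤ c) :
    ∑ l ∈ Finset.range (Nat.log p N + 2),
        levelConst p c l * (if l = 0 then 1 else (p : ℝ)) * (p : ℝ) ^ l *
          min 1 ((N : ℝ) / (p : ℝ) ^ l) ≤
      1 + c * Real.log N * (p : ℝ) ^ 2 / Real.log p := by
  have hp' : (2 : ℝ) ≤ p := by exact_mod_cast hp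
  have hN' : (1 : ℝ) ≤ N := by exact_mod_cast (by omega : 1 ≤ N)
  have hlp : 0 < Real.log p := Real.log_pos (by linarith)
  have hsucc : ∀ l, levelConst p c (l + 1) * (if l + 1 = 0 then 1 else (p : ℝ)) *
      (p : ℝ) ^ (l + 1) * min 1 ((N : ℝ) / (p : ℝ) ^ (l + 1)) =
      c * (p : ℝ) ^ 2 / 6 * min 1 ((N : ℝ) / (p : ℝ) ^ (l + 1)) := fun l => by
    rw [levelConst, if_neg l.succ_ne_zero]
    congr 1
    field_simp
    ring
  rw [Finset.sum_range_succ', Finset.sum_congr rfl fun l _ => hsucc l, ← Finset.mul_sum,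
    Finset.sum_range_succ]
  have hsum : ∑ l ∈ Finset.range (Nat.log p N), min 1 ((N : ℝ) / (p : ℝ) ^ (l + 1)) ≤
      Nat.log p N :=
    (Finset.sum_le_sum fun l _ => min_le_left _ _).trans_eq (by simp)
  have hlog := log_add_min_le hp hN
  have hone : 1 ≤ (p : ℝ) ^ 2 * (Real.log N / Real.log p) := by
    rw [← mul_div_assoc, one_le_div hlp]
    have h1 := Real.log_le_sub_one_of_pos (by linarith : (0 : ℝ) < p)
    nlinarith [half_le_log hN]
  have hbound := mul_le_mul_of_nonneg_left ((add_le_add_left hsum _).trans hlog)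
    (by positivity : 0 ≤ c * (p : ℝ) ^ 2 / 6)
  have hone' := mul_le_mul_of_nonneg_left hone hc
  simp only [levelConst, if_true, pow_zero, div_one, min_eq_left hN', mul_one]
  have heq : c * Real.log N * (p : ℝ) ^ 2 / Real.log p =
      c * ((p : ℝ) ^ 2 * (Real.log N / Real.log p)) := by ring
  rw [heq]
  linarith

/-- Theorem 1 of [HKP14], explicit bound: mean square worst-case error of
the `p`-adically shifted Halton point set, averaged over all shifts `σ ∈ [0,1)^s`. -/
theorem mean_square_error_shifted_halton
    (s N : ℕ) (hN : 2 ≤ N)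
    (p : ℕ → ℕ) (hp : ∀ j < s, (p j).Prime)
    (hdist : ∀ i < s, ∀ j < s, p i = p j → i = j)
    (γ : ℕ → ℝ) (hγpos : ∀ j, 0 < γ j) (hγ1 : γ 0 ≤ 1) (hγmon : Antitone γ) :
    (∫ σ in (Set.univ.pi fun _ : Fin s => Set.Ico (0 : ℝ) 1),
        sqErr s N γ fun n j => pshift (p j.val) (radInv (p j.val) n.val) (σ j)) ≤
      1 / (N : ℝ) ^ 2 *
        ((∏ j ∈ Finset.range s, (1 + γ j * Real.log N * (p j : ℝ) ^ 2 / Real.log (p j))) +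
          (∏ j ∈ Finset.range s, (1 + γ j / 2)) *
            ∏ j ∈ Finset.range s, (1 + γ j * (p j : ℝ) / 6)) := by
  have hp' : ∀ j : Fin s, (p j).Prime := fun j => hp j j.isLt
  have hinj : Function.Injective fun j : Fin s => p j := fun i j h =>
    Fin.ext (hdist i i.isLt j j.isLt h)
  have hN' : (0 : ℝ) < N := by exact_mod_cast (by omega : 0 < N)
  have hsum := (sum_sum_prod_shiftDist_le hp' hinj (c := fun j : Fin s => γ j)
    (fun j => (hγpos j).le) (N := N) (by omega)).trans (add_le_add_right
      (Finset.prod_le_prod (fun i _ => Finset.sum_nonneg fun l _ => by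
        have := levelConst_nonneg (p i) (hγpos i).le l
        split_ifs <;> positivity) fun i _ => sum_levelBound_le (hp' i).two_le hN (hγpos i).le) _)
  have hnn : 0 ≤ (∏ j ∈ Finset.range s, (1 + γ j / 2)) *
      ∏ j ∈ Finset.range s, (1 + γ j * (p j : ℝ) / 6) :=
    mul_nonneg (Finset.prod_nonneg fun j _ => by have := hγpos j; positivity)
      (Finset.prod_nonneg fun j _ => by have := hγpos j; positivity)
  rw [integral_sqErr_pshift (by omega) hp' γ]
  rw [← Fin.prod_univ_eq_prod_range
    fun j => 1 + γ j * Real.log N * (p j : ℝ) ^ 2 / Real.log (p j)]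
  rw [sub_le_iff_le_add, one_div_mul_eq_div, one_div_mul_eq_div, div_le_iff₀ (by positivity),
    add_mul, div_mul_cancel₀ _ (by positivity)]
  linarith
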